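/- arXiv:2603.13523 — 4 statements merged into one kernel-verified Lean document; each statement's English description precedes it below -/
import Mathlib

section
/- Let (G_i)_{i∈I} be a family of groups and (φ_i : G_i → H)_{i∈I} a family of surjective group homomorphisms onto a fixed group H. Let G = {(g_i) ∈ Π_{i∈I} G_i : φ_i(g_i) = φ_j(g_j) for all i, j ∈ I} be the fiber product of the G_i over H. Then the center of G satisfies Z(G) = {(g_i) ∈ G : g_i ∈ Z(G_i) for all i ∈ I}. -/
/-!
Statement 3: the center of a fiber product of groups over a common quotient
(Lemma `lemma:centro` in the paper).
-/

variable {I : Type*} {H : Type*} [Group H] {G : I → Type*} [∀ i, Group (G i)]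

/-- The fiber product `G₁ ×_H G₂ ×_H ⋯` of a family of groups `G i` along homomorphisms
`φ i : G i →* H`, as a subgroup of the direct product. -/
def fiberProduct (φ : ∀ i, G i →* H) : Subgroup (∀ i, G i) where
  carrier := {g | ∀ i j, φ i (g i) = φ j (g j)}
  one_mem' := by intro i j; simp
  mul_mem' := by
    intro a b ha hb i j
    simp only [Pi.mul_apply, map_mul, ha i j, hb i j]
  inv_mem' := by
    intro a ha i j
    simp only [Pi.inv_apply, map_inv, ha i j]

/-- If all the `φ i : G i →* H` are surjective, then the center of the
fiber product `G = {(g_i) : φ i (g i) = φ j (g j) ∀ i j}` is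
`Z(G) = {(g_i) ∈ G : g_i ∈ Z(G_i) for all i}`. -/
theorem center_fiberProduct (φ : ∀ i, G i →* H) (hφ : ∀ i, Function.Surjective (φ i))
    (g : fiberProduct φ) :
    g ∈ Subgroup.center (fiberProduct φ) ↔ ∀ i, (g : ∀ i, G i) i ∈ Subgroup.center (G i) := by
  classical
  simp only [Subgroup.mem_center_iff]
  constructor
  · intro h i x
    choose s hs using fun j => hφ j (φ i x)
    have hy : ∀ j, φ j (Function.update s i x j) = φ i x := by
      intro j
      by_cases hj : j = i
      · subst hj
        simp
      · simp [hj, hs]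
    have hmem : Function.update s i x ∈ fiberProduct φ := fun j k => (hy j).trans (hy k).symm
    simpa using congrFun (congrArg Subtype.val (h ⟨_, hmem⟩)) i
  · exact fun h y => Subtype.ext (funext fun i => h i (y.1 i))
end

section
/- Let K be a number field and (L_i)_{i∈I} a family of Galois extensions of K lying in a common algebraic closure, with Galois groups G_i = Gal(L_i/K). Let L denote the compositum of all the L_i and G = Gal(L/K). Then the subfield of L fixed by the center Z(G) equals the compositum of the fixed fields L_i^{Z(G_i)}. -/
/-!
Statement 4: the field fixed by the center of the Galois group of a compositum is the
compositum of the fields fixed by the centers (Lemma `lemma:centrocomposito` in the paper).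
-/

open IntermediateField

namespace IntermediateField

open scoped commutatorElement

variable {K Ω : Type*} [Field K] [Field Ω] [Algebra K Ω]

theorem mem_fixingSubgroup_iSup_iff {ι : Type*} {E : ι → IntermediateField K Ω} {σ : Gal(Ω/K)} :
    σ ∈ (⨆ i, E i).fixingSubgroup ↔ ∀ i, σ ∈ (E i).fixingSubgroup := by
  simp only [← Subgroup.zpowers_le, ← le_iff_le, iSup_le_iff]

theorem fixingSubgroup_injective [IsGalois K Ω] :
    Function.Injective (fixingSubgroup : IntermediateField K Ω → Subgroup Gal(Ω/K)) :=
  Function.LeftInverse.injective fun E ↦ InfiniteGalois.fixedField_fixingSubgroup E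

theorem fixingSubgroup_fixedField_center [IsGalois K Ω] :
    (fixedField (Subgroup.center Gal(Ω/K))).fixingSubgroup = Subgroup.center Gal(Ω/K) := by
  have isClosed : IsClosed (Subgroup.center Gal(Ω/K) : Set Gal(Ω/K)) := by
    rw [Subgroup.coe_center, ← Set.centralizer_univ]
    exact Set.isClosed_centralizer _
  exact InfiniteGalois.fixingSubgroup_fixedField ⟨Subgroup.center Gal(Ω/K), isClosed⟩

theorem fixingSubgroup_lift (E : IntermediateField K Ω) [Normal K E] (F : IntermediateField K E) :
    (lift F).fixingSubgroup = F.fixingSubgroup.comap (AlgEquiv.restrictNormalHom E) := by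
  ext σ
  simp only [Subgroup.mem_comap, mem_fixingSubgroup_iff]
  constructor
  · intro h x hx
    apply Subtype.val_injective
    rw [AlgEquiv.restrictNormalHom_apply]
    exact h x ((mem_lift x).2 hx)
  · intro h x hx
    have hxE := lift_le F hx
    have := congrArg Subtype.val (h ⟨x, hxE⟩ ((mem_lift (⟨x, hxE⟩ : E)).1 hx))
    rwa [AlgEquiv.restrictNormalHom_apply] at this

/-- An automorphism restricts to a central element of `Gal(E/K)` exactly when all of its
commutators fix `E`. -/
theorem mem_fixingSubgroup_lift_fixedField_center_iff [Normal K Ω] (E : IntermediateField K Ω)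
    [IsGalois K E] {σ : Gal(Ω/K)} :
    σ ∈ (lift (fixedField (Subgroup.center Gal(E/K)))).fixingSubgroup ↔
      ∀ τ : Gal(Ω/K), ⁅τ, σ⁆ ∈ E.fixingSubgroup := by
  rw [fixingSubgroup_lift, fixingSubgroup_fixedField_center, Subgroup.mem_comap,
    Subgroup.mem_center_iff, (AlgEquiv.restrictNormalHom_surjective (K₁ := E) Ω).forall]
  simp only [← restrictNormalHom_ker, MonoidHom.mem_ker, map_commutatorElement,
    commutatorElement_eq_one_iff_mul_comm]

end IntermediateField

/-- Let `K` be a number field and `(L i)` a family of Galois extensions of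
`K` inside a common algebraic closure `Ω`.  Let `L = ⨆ i, L i` be their compositum and
`G = Gal(L/K)`.  Then `L^{Z(G)}` is the compositum of the fixed fields `(L i)^{Z(G i)}`. -/
theorem fixedField_center_iSup
    (K : Type*) [Field K] [NumberField K]
    {ι : Type*} (L : ι → IntermediateField K (AlgebraicClosure K))
    [∀ i, IsGalois K (L i)] :
    lift (fixedField (Subgroup.center
        ((⨆ i, L i : IntermediateField K (AlgebraicClosure K)) ≃ₐ[K]
          (⨆ i, L i : IntermediateField K (AlgebraicClosure K))))) =
      ⨆ i, lift (fixedField (Subgroup.center ((L i) ≃ₐ[K] (L i)))) := by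
  have : IsGalois K (⨆ i, L i : IntermediateField K (AlgebraicClosure K)) := ⟨⟩
  refine fixingSubgroup_injective (Subgroup.ext fun σ ↦ ?_)
  simp only [mem_fixingSubgroup_iSup_iff, mem_fixingSubgroup_lift_fixedField_center_iff]
  exact forall_comm
end

section
/- Let p ≥ 3 be a prime and let A be a finite product of commutative 𝔽_p-algebras. Let M₂(A)⁰ denote the 𝔽_p-vector space of 2×2 matrices over A with trace zero, and M₂(𝔽_p)⁰ its subspace of trace-zero matrices with entries in 𝔽_p (embedded diagonally in A). Let V be an 𝔽_p-subspace of M₂(A)⁰ such that V ∩ M₂(𝔽_p)⁰ is nontrivial and such that V is invariant under the adjoint action of SL₂(A), i.e. g·X·g⁻¹ ∈ V for all g ∈ SL₂(A) and X ∈ V. Then V = M₂(A)⁰. -/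
/-!
Statement 6: an `𝔽_p`-subspace of the trace-zero `2×2` matrices over a finite product of
commutative `𝔽_p`-algebras which meets `M₂(𝔽_p)⁰` nontrivially and is stable under the
adjoint action of `SL₂` is everything (Proposition A.2.5 of Amoroso–Terracini).
-/

section AdjointInvariant

variable {K R : Type*} [Field K] [CommRing R] [Algebra K R]
  {V : Submodule K (Matrix (Fin 2) (Fin 2) R)}

/-- Conjugation by the upper unipotent matrix with parameter `t`. -/
theorem upper_unipotent_conj_mem
    (hinv : ∀ g : Matrix (Fin 2) (Fin 2) R, g.det = 1 → ∀ X ∈ V, g * X * g⁻¹ ∈ V)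
    {a b c : R} (h : !![a, b; c, -a] ∈ V) (t : R) :
    !![a + t * c, b - 2 * t * a - t ^ 2 * c; c, -(a + t * c)] ∈ V := by
  have hdet : (!![1, t; 0, 1] : Matrix (Fin 2) (Fin 2) R).det = 1 := by simp
  convert hinv _ hdet _ h using 1
  rw [Matrix.inv_def, hdet, Matrix.adjugate_fin_two_of]
  ext i j
  fin_cases i <;> fin_cases j <;> simp [Matrix.mul_apply, Fin.sum_univ_two] <;> ring

/-- Conjugation by the Weyl element. -/
theorem weyl_conj_mem
    (hinv : ∀ g : Matrix (Fin 2) (Fin 2) R, g.det = 1 → ∀ X ∈ V, g * X * g⁻¹ ∈ V)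
    {a b c : R} (h : !![a, b; c, -a] ∈ V) : !![-a, -c; -b, - -a] ∈ V := by
  have hdet : (!![0, 1; -1, 0] : Matrix (Fin 2) (Fin 2) R).det = 1 := by simp
  convert hinv _ hdet _ h using 1
  rw [Matrix.inv_def, hdet, Matrix.adjugate_fin_two_of]
  ext i j
  fin_cases i <;> fin_cases j <;> simp [Matrix.mul_apply, Fin.sum_univ_two]

theorem traceZero_mem_of_lower_left_ne_zero (h2 : (2 : K) ≠ 0)
    (hinv : ∀ g : Matrix (Fin 2) (Fin 2) R, g.det = 1 → ∀ X ∈ V, g * X * g⁻¹ ∈ V)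
    {a b : R} {c : K} (hc : c ≠ 0) (h : !![a, b; algebraMap K R c, -a] ∈ V) (x y z : R) :
    !![x, y; z, -x] ∈ V := by
  have hcR : algebraMap K R c⁻¹ * algebraMap K R c = 1 := by
    rw [← map_mul, inv_mul_cancel₀ hc, map_one]
  have h2R : algebraMap K R 2⁻¹ * 2 = 1 := by
    rw [← map_ofNat (algebraMap K R) 2, ← map_mul, inv_mul_cancel₀ h2, map_one]
  have hsq (t : R) : !![0, t ^ 2; 0, -0] ∈ V := by
    have key := V.smul_mem (-(c⁻¹ * 2⁻¹)) (V.sub_mem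
      (V.add_mem (upper_unipotent_conj_mem hinv h t) (upper_unipotent_conj_mem hinv h (-t)))
      (V.add_mem h h))
    convert key using 1
    ext i j
    fin_cases i <;> fin_cases j <;> simp [Algebra.smul_def]
    · ring
    · linear_combination (-t ^ 2) * hcR - t ^ 2 * h2R * algebraMap K R c⁻¹ * algebraMap K R c
    · ring
  have hE (r : R) : !![0, r; 0, -0] ∈ V := by
    have key := V.sub_mem (hsq ((r + 1) * algebraMap K R 2⁻¹)) (hsq ((r - 1) * algebraMap K R 2⁻¹))
    convert key using 1
    ext i j
    fin_cases i <;> fin_cases j <;> simp only [Matrix.sub_apply] <;> simp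
    linear_combination (-r) * h2R * (algebraMap K R 2⁻¹ * 2 + 1)
  have hF (r : R) : !![0, 0; r, -0] ∈ V := by
    simpa using weyl_conj_mem hinv (hE (-r))
  convert V.add_mem (V.add_mem (upper_unipotent_conj_mem hinv (hF 1) x) (hF (z - 1)))
    (hE (y + x ^ 2)) using 1
  ext i j
  fin_cases i <;> fin_cases j <;> simp

theorem traceZero_mem_of_scalar_mem (h2 : (2 : K) ≠ 0)
    (hinv : ∀ g : Matrix (Fin 2) (Fin 2) R, g.det = 1 → ∀ X ∈ V, g * X * g⁻¹ ∈ V)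
    {a b c : K} (habc : ¬ (a = 0 ∧ b = 0 ∧ c = 0))
    (h : !![algebraMap K R a, algebraMap K R b; algebraMap K R c, -algebraMap K R a] ∈ V)
    (x y z : R) : !![x, y; z, -x] ∈ V := by
  by_cases hc : c = 0
  · by_cases hb : b = 0
    · have ha : a ≠ 0 := fun ha => habc ⟨ha, hb, hc⟩
      subst hb hc
      have h' := weyl_conj_mem hinv (upper_unipotent_conj_mem hinv h 1)
      refine traceZero_mem_of_lower_left_ne_zero h2 hinv (mul_ne_zero h2 ha)
        (a := -algebraMap K R a) (b := 0) ?_ x y z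
      simpa [map_ofNat (algebraMap K R) 2] using h'
    · refine traceZero_mem_of_lower_left_ne_zero h2 hinv (neg_ne_zero.mpr hb)
        (a := -algebraMap K R a) (b := -algebraMap K R c) ?_ x y z
      simpa using weyl_conj_mem hinv h
  · exact traceZero_mem_of_lower_left_ne_zero h2 hinv hc h x y z

end AdjointInvariant

/-- Let `p ≥ 3` be a prime and `A = Π i, A i` a finite product of
commutative `𝔽_p`-algebras.  Let `V ⊆ M₂(A)⁰` be an `𝔽_p`-subspace of the trace-zero
matrices such that `V ∩ M₂(𝔽_p)⁰ ≠ 0` and `g • V • g⁻¹ ⊆ V` for all `g ∈ SL₂(A)`.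
Then `V = M₂(A)⁰`. -/
theorem subspace_eq_traceZero_of_sl2_invariant
    (p : ℕ) (hp : p.Prime) (hp3 : 3 ≤ p)
    {ι : Type*} [Fintype ι] (A : ι → Type*) [∀ i, CommRing (A i)]
    [∀ i, Algebra (ZMod p) (A i)]
    (V : Submodule (ZMod p) (Matrix (Fin 2) (Fin 2) (∀ i, A i)))
    -- `V` consists of trace-zero matrices
    (hV0 : ∀ X ∈ V, Matrix.trace X = 0)
    -- `V ∩ M₂(𝔽_p)⁰` is nontrivial : some nonzero element of `V` has all entries in the
    -- image of `𝔽_p` (being in `V`, it automatically has trace zero)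
    (hmeet : ∃ X ∈ V, X ≠ 0 ∧ ∀ k l : Fin 2,
      X k l ∈ Set.range (algebraMap (ZMod p) (∀ i, A i)))
    -- invariance under the adjoint action of `SL₂(A)`
    (hinv : ∀ g : Matrix (Fin 2) (Fin 2) (∀ i, A i), g.det = 1 →
      ∀ X ∈ V, g * X * g⁻¹ ∈ V) :
    ∀ X : Matrix (Fin 2) (Fin 2) (∀ i, A i), Matrix.trace X = 0 → X ∈ V := by
  have : Fact p.Prime := ⟨hp⟩
  have h2 : (2 : ZMod p) ≠ 0 := by
    refine Ring.two_ne_zero ?_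
    rw [ZMod.ringChar_zmod_n]
    lia
  have eta {X : Matrix (Fin 2) (Fin 2) (∀ i, A i)} (hX : X.trace = 0) :
      X = !![X 0 0, X 0 1; X 1 0, -X 0 0] := by
    rw [Matrix.trace_fin_two] at hX
    rw [← eq_neg_of_add_eq_zero_right hX]
    exact Matrix.eta_fin_two X
  obtain ⟨X, hX, hX0, hent⟩ := hmeet
  obtain ⟨a, ha⟩ := hent 0 0
  obtain ⟨b, hb⟩ := hent 0 1
  obtain ⟨c, hc⟩ := hent 1 0
  have hXe := eta (hV0 X hX)
  rw [← ha, ← hb, ← hc] at hXe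
  intro Y hY
  rw [eta hY]
  refine traceZero_mem_of_scalar_mem h2 hinv (a := a) (b := b) (c := c) ?_ (hXe ▸ hX) _ _ _
  rintro ⟨rfl, rfl, rfl⟩
  apply hX0
  rw [hXe]
  ext i j
  fin_cases i <;> fin_cases j <;> simp
end

section
/- Let p ≥ 5 be a prime and m ≥ 1 an integer such that (p+1)/2 does not divide m. Set δ = (p²−1)/gcd(p²−1, m) and s = (p−1)/gcd(p−1, m). Then δ > 2s. -/
/-!
Statement 12: the numerical inequality `δ > 2s` used in the proof of the normal closure
lemma, where `δ = (p²−1)/(p²−1, m)` and `s = (p−1)/(p−1, m)`.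
-/

theorem Nat.div_gcd_mul_div_gcd_le {a b : ℕ} (ha : 0 < a) (hb : 0 < b) (m : ℕ) :
    a / a.gcd m * (b / b.gcd m) ≤ a * b / (a * b).gcd m := by
  have hdvd : (a * b).gcd m ∣ a.gcd m * b.gcd m :=
    Nat.gcd_mul_left_dvd_mul_gcd m a b
  rw [Nat.div_mul_div_comm (Nat.gcd_dvd_left a m) (Nat.gcd_dvd_left b m)]
  exact Nat.div_le_div_left
    (Nat.le_of_dvd (Nat.mul_pos (Nat.gcd_pos_of_pos_left m ha) (Nat.gcd_pos_of_pos_left m hb)) hdvd)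
    (Nat.gcd_pos_of_pos_left m (Nat.mul_pos ha hb))

theorem Nat.two_lt_div_gcd_of_even {n m : ℕ} (hn : 0 < n) (heven : Even n) (h : ¬ n / 2 ∣ m) :
    2 < n / n.gcd m := by
  by_contra! hle
  refine h (dvd_trans ?_ (Nat.gcd_dvd_right n m))
  have hpos : 0 < n / n.gcd m := Nat.div_gcd_pos_of_pos_left m hn
  have hmul : n.gcd m * (n / n.gcd m) = n := Nat.mul_div_cancel' (Nat.gcd_dvd_left n m)
  obtain hq | hq : n / n.gcd m = 1 ∨ n / n.gcd m = 2 := by omega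
  · rw [hq, mul_one] at hmul
    rw [hmul]
    exact Nat.div_dvd_of_dvd heven.two_dvd
  · rw [hq] at hmul
    exact dvd_of_eq (by omega)

/-- Let `p ≥ 5` be a prime and `m ≥ 1` an integer such that `(p+1)/2 ∤ m`.
Setting `δ = (p²−1)/gcd(p²−1, m)` and `s = (p−1)/gcd(p−1, m)`, one has `δ > 2s`. -/
theorem delta_gt_two_s (p m : ℕ) (hp : p.Prime) (hp5 : 5 ≤ p) (hm : 1 ≤ m)
    (hnd : ¬ ((p + 1) / 2 ∣ m)) :
    2 * ((p - 1) / Nat.gcd (p - 1) m) < (p ^ 2 - 1) / Nat.gcd (p ^ 2 - 1) m := by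
  have heven : Even (p + 1) := (hp.odd_of_ne_two (by omega)).add_one
  have hs : 0 < (p - 1) / (p - 1).gcd m := Nat.div_gcd_pos_of_pos_left m (by omega)
  have hfactor : p ^ 2 - 1 = (p - 1) * (p + 1) := by
    simpa [mul_comm] using Nat.sq_sub_sq p 1
  rw [hfactor]
  calc 2 * ((p - 1) / (p - 1).gcd m)
      < (p - 1) / (p - 1).gcd m * ((p + 1) / (p + 1).gcd m) := by
        rw [mul_comm]
        exact Nat.mul_lt_mul_of_pos_left
          (Nat.two_lt_div_gcd_of_even p.succ_pos heven hnd) hs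
    _ ≤ _ := Nat.div_gcd_mul_div_gcd_le (by omega) p.succ_pos m
end
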